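/- arXiv:0902.1414 — 2 statements merged into one kernel-verified Lean document; each statement's English description precedes it below -/
import Mathlib

section
/- Let U, V ⊆ ℝⁿ be open sets and let F : U → V be a bijection such that both F and F⁻¹ are Lipschitz and F is locally DC on U. Then F⁻¹ is locally DC on V. -/
open scoped NNReal

open Set

/-- `f` is DC on the convex set `C`: a difference of two continuous convex functions on `C`. -/
def IsDCOn {E : Type*} [NormedAddCommGroup E] [NormedSpace ℝ E]
    (C : Set E) (f : E → ℝ) : Prop :=
  ∃ g h : E → ℝ, ConvexOn ℝ C g ∧ ConvexOn ℝ C h ∧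
    ContinuousOn g C ∧ ContinuousOn h C ∧ ∀ x ∈ C, f x = g x - h x

/-- A mapping `F : C → F'` is DC if `ℓ ∘ F` is DC for every linear functional `ℓ`. -/
def IsDCMapOn {E F' : Type*} [NormedAddCommGroup E] [NormedSpace ℝ E]
    [NormedAddCommGroup F'] [NormedSpace ℝ F'] (C : Set E) (F : E → F') : Prop :=
  ∀ ℓ : F' →ₗ[ℝ] ℝ, IsDCOn C (fun x => ℓ (F x))

/-- `F` is locally DC on the open set `U`: every point of `U` has an open convex
neighborhood contained in `U` on which `F` is DC. -/
def LocallyDCMapOn {E F' : Type*} [NormedAddCommGroup E] [NormedSpace ℝ E]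
    [NormedAddCommGroup F'] [NormedSpace ℝ F'] (U : Set E) (F : E → F') : Prop :=
  ∀ x ∈ U, ∃ V : Set E, IsOpen V ∧ Convex ℝ V ∧ x ∈ V ∧ V ⊆ U ∧ IsDCMapOn V F

open Filter Topology

/-- A continuous function that is locally midpoint convex is convex. -/
theorem convexOn_of_eventually_midpoint {E : Type*} [NormedAddCommGroup E] [NormedSpace ℝ E]
    {C : Set E} {φ : E → ℝ} (hC : Convex ℝ C) (hφ : ContinuousOn φ C)
    (h : ∀ x ∈ C, ∀ᶠ v in 𝓝 (0 : E), 2 * φ x ≤ φ (x + v) + φ (x - v)) :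
    ConvexOn ℝ C φ := by
  refine ⟨hC, fun x hx y hy a b ha hb hab => ?_⟩
  by_contra! hlt
  have hmem : ∀ t ∈ Icc (0 : ℝ) 1, x + t • (y - x) ∈ C := fun t ht =>
    hC.add_smul_sub_mem hx hy ht
  set ψ : ℝ → ℝ := fun t => φ (x + t • (y - x)) - (φ x + t * (φ y - φ x)) with hψ
  have hψc : ContinuousOn ψ (Icc 0 1) := by
    refine ContinuousOn.sub (hφ.comp (by fun_prop) hmem) (by fun_prop)
  have hψ0 : ψ 0 = 0 := by simp [hψ]
  have hψ1 : ψ 1 = 0 := by simp [hψ]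
  have hb1 : b ∈ Icc (0 : ℝ) 1 := ⟨hb, by linarith⟩
  have hψb : 0 < ψ b := by
    have e : x + b • (y - x) = a • x + b • y := by
      rw [← eq_sub_iff_add_eq] at hab
      subst hab
      module
    simp only [hψ, e]
    simp only [smul_eq_mul] at hlt
    rw [← eq_sub_iff_add_eq] at hab
    subst hab
    linarith
  obtain ⟨s, hs, hsmax⟩ := isCompact_Icc.exists_isMaxOn (nonempty_of_mem hb1) hψc
  have hK : IsCompact (Icc (0 : ℝ) 1 ∩ ψ ⁻¹' {ψ s}) := by
    refine isCompact_Icc.of_isClosed_subset ?_ inter_subset_left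
    exact hψc.preimage_isClosed_of_isClosed isClosed_Icc isClosed_singleton
  obtain ⟨t, ⟨ht, hts⟩, htmin⟩ := hK.exists_isLeast ⟨s, hs, rfl⟩
  have hts : ψ t = ψ s := hts
  have hpos : 0 < ψ t := hts ▸ hψb.trans_le (hsmax hb1)
  have ht0 : 0 < t := lt_of_le_of_ne ht.1 fun h0 => by
    rw [← h0, hψ0] at hpos
    exact hpos.false
  have ht1 : t < 1 := lt_of_le_of_ne ht.2 fun h0 => by
    rw [h0, hψ1] at hpos
    exact hpos.false
  have hlim : Tendsto (fun δ : ℝ => δ • (y - x)) (𝓝[>] 0) (𝓝 0) := by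
    have : Tendsto (fun δ : ℝ => δ • (y - x)) (𝓝 0) (𝓝 ((0 : ℝ) • (y - x))) :=
      Continuous.tendsto (by fun_prop) 0
    rw [zero_smul] at this
    exact this.mono_left nhdsWithin_le_nhds
  obtain ⟨δ, hδ, hδm⟩ := ((hlim.eventually (h _ (hmem t ht))).and
    (Ioo_mem_nhdsGT (lt_min ht0 (sub_pos.2 ht1)))).exists
  have hδt : δ < t := hδm.2.trans_le (min_le_left _ _)
  have hδt' : δ < 1 - t := hδm.2.trans_le (min_le_right _ _)
  have hδ0 : 0 < δ := hδm.1
  have h1 : ψ (t + δ) ≤ ψ s := hsmax ⟨by linarith, by linarith⟩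
  have hl : t - δ ∈ Icc (0 : ℝ) 1 := ⟨by linarith, by linarith⟩
  have h2 : ψ (t - δ) < ψ s := lt_of_le_of_ne (hsmax hl) fun h0 => by
    have := htmin ⟨hl, h0⟩
    linarith
  have e1 : x + t • (y - x) + δ • (y - x) = x + (t + δ) • (y - x) := by module
  have e2 : x + t • (y - x) - δ • (y - x) = x + (t - δ) • (y - x) := by module
  rw [e1, e2] at hδ
  simp only [hψ] at h1 h2 hts
  linarith

theorem ConvexOn.two_mul_le_add_sub {E : Type*} [AddCommGroup E] [Module ℝ E]
    {C : Set E} {φ : E → ℝ} (h : ConvexOn ℝ C φ) {x v : E} (h1 : x + v ∈ C) (h2 : x - v ∈ C) :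
    2 * φ x ≤ φ (x + v) + φ (x - v) := by
  have := h.2 h1 h2 (show (0 : ℝ) ≤ 1 / 2 by norm_num) (show (0 : ℝ) ≤ 1 / 2 by norm_num)
    (by norm_num)
  rw [show (1 / 2 : ℝ) • (x + v) + (1 / 2 : ℝ) • (x - v) = x by module] at this
  simp only [smul_eq_mul] at this
  linarith

theorem convexOn_finsetSum {E ι : Type*} [AddCommGroup E] [Module ℝ E] {C : Set E}
    (hC : Convex ℝ C) (s : Finset ι) {φ : ι → E → ℝ} (h : ∀ i ∈ s, ConvexOn ℝ C (φ i)) :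
    ConvexOn ℝ C (fun x => ∑ i ∈ s, φ i x) := by
  classical
  induction s using Finset.induction_on with
  | empty => simpa using convexOn_const (0 : ℝ) hC
  | insert i s hi ih =>
    simp only [Finset.sum_insert hi]
    exact (h i (by simp)).add (ih fun j hj => h j (by simp [hj]))

/-- A continuous function all of whose values are taken among those of finitely many DC
functions is DC. -/
theorem IsDCOn.of_forall_exists_eq {E ι : Type*} [NormedAddCommGroup E] [NormedSpace ℝ E]
    [Fintype ι] {C : Set E} (hCo : IsOpen C) (hC : Convex ℝ C) {H : E → ℝ} {h : ι → E → ℝ}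
    (hH : ContinuousOn H C) (hh : ∀ i, IsDCOn C (h i)) (hsel : ∀ x ∈ C, ∃ i, H x = h i x) :
    IsDCOn C H := by
  classical
  choose p q hp hq hpc hqc hpq using hh
  set c : E → ℝ := fun x => ∑ i, (p i x + q i x) with hc
  set u : ι → E → ℝ := fun j x => (∑ i ∈ Finset.univ.erase j, (p i x + q i x)) + (q j x + q j x)
    with hu
  have hcu : ∀ j, ∀ x ∈ C, h j x = c x - u j x := by
    intro j x hx
    simp only [hc, hu, hpq j x hx, ← Finset.add_sum_erase _ _ (Finset.mem_univ j)]
    ring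
  have hcC : ConvexOn ℝ C c := convexOn_finsetSum hC _ fun i _ => (hp i).add (hq i)
  have huC : ∀ j, ConvexOn ℝ C (u j) := fun j =>
    (convexOn_finsetSum hC _ fun i _ => (hp i).add (hq i)).add ((hq j).add (hq j))
  have hhc : ∀ j, ContinuousOn (h j) C := fun j =>
    ((hpc j).sub (hqc j)).congr fun x hx => hpq j x hx
  have huc : ∀ j, ContinuousOn (u j) C := fun j =>
    (continuousOn_finsetSum _ fun i _ => (hpc i).add (hqc i)).add ((hqc j).add (hqc j))
  set w : ι × ι → E → ℝ := fun jk x => max (u jk.1 x) (u jk.2 x) with hw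
  have hwC : ∀ jk, ConvexOn ℝ C (w jk) := fun jk => (huC jk.1).sup (huC jk.2)
  have hwc : ∀ jk, ContinuousOn (w jk) C := fun jk => (huc jk.1).sup (huc jk.2)
  set g : E → ℝ := fun x => ∑ jk, w jk x with hg
  have hgC : ConvexOn ℝ C g := convexOn_finsetSum hC _ fun i _ => hwC i
  have hgc : ContinuousOn g C := continuousOn_finsetSum _ fun i _ => hwc i
  refine ⟨fun x => H x + g x, g, ?_, hgC, hH.add hgc, hgc, fun x _ => by ring⟩
  refine convexOn_of_eventually_midpoint hC (hH.add hgc) fun x hx => ?_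
  have hev : ∀ᶠ y in 𝓝 x, y ∈ C ∧ ∀ j, H y = h j y → H x = h j x := by
    refine (hCo.eventually_mem hx).and (eventually_all.2 fun j => ?_)
    by_cases hj : H x = h j x
    · exact Eventually.of_forall fun _ _ => hj
    · have h1 := hH.continuousAt (hCo.mem_nhds hx)
      have h2 := (hhc j).continuousAt (hCo.mem_nhds hx)
      filter_upwards [(h1.ne_iff_eventually_ne h2).1 hj] with y hy hy'
      exact absurd hy' hy
  have t1 : Tendsto (fun v : E => x + v) (𝓝 0) (𝓝 x) := by
    simpa using (show Continuous fun v : E => x + v by fun_prop).tendsto 0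
  have t2 : Tendsto (fun v : E => x - v) (𝓝 0) (𝓝 x) := by
    simpa using (show Continuous fun v : E => x - v by fun_prop).tendsto 0
  filter_upwards [t1.eventually hev, t2.eventually hev] with v ⟨hv1, hv1'⟩ ⟨hv2, hv2'⟩
  obtain ⟨j, hj⟩ := hsel _ hv1
  obtain ⟨k, hk⟩ := hsel _ hv2
  have hxj := hv1' j hj
  have hxk := hv2' k hk
  rw [hcu _ _ hv1] at hj
  rw [hcu _ _ hv2] at hk
  rw [hcu _ _ hx] at hxj hxk
  have hwx : w (j, k) x = c x - H x := by
    simp only [hw, show u j x = c x - H x by linarith, show u k x = c x - H x by linarith,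
      max_self]
  have hw1 : u j (x + v) ≤ w (j, k) (x + v) := le_max_left _ _
  have hw2 : u k (x - v) ≤ w (j, k) (x - v) := le_max_right _ _
  have hc2 := hcC.two_mul_le_add_sub hv1 hv2
  have hsum : w (j, k) (x + v) + w (j, k) (x - v) - 2 * w (j, k) x
      ≤ ∑ jk, (w jk (x + v) + w jk (x - v) - 2 * w jk x) :=
    Finset.single_le_sum (f := fun jk => w jk (x + v) + w jk (x - v) - 2 * w jk x)
      (fun jk _ => sub_nonneg.2 ((hwC jk).two_mul_le_add_sub hv1 hv2)) (Finset.mem_univ (j, k))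
  rw [Finset.sum_sub_distrib, Finset.sum_add_distrib, ← Finset.mul_sum] at hsum
  simp only [hg]
  linarith

/-- The inverse of a small Lipschitz perturbation `A + e` of a linear isomorphism is DC, provided
the second differences of `e` are controlled by those of a function with small Lipschitz
constant. -/
theorem isDCMapOn_univ_of_rightInverse {E : Type*} [NormedAddCommGroup E] [NormedSpace ℝ E]
    [FiniteDimensional ℝ E] {A : E →L[ℝ] E} {e G : E → E} {f : E → ℝ} {L c : ℝ}
    (hL : 0 ≤ L) (hc : 0 ≤ c) (hLc : L * c ≤ 1 / 4) (hA : ∀ v, ‖v‖ ≤ L * ‖A v‖)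
    (he : ∀ x y, ‖e x - e y‖ ≤ c * ‖x - y‖) (hf : ∀ x y, |f x - f y| ≤ c * ‖x - y‖)
    (hfc : Continuous f) (hef : ∀ m v, ‖e (m + v) + e (m - v) - (2 : ℝ) • e m‖
      ≤ f (m + v) + f (m - v) - 2 * f m)
    (hG : Continuous G) (hAG : ∀ w, A (G w) + e (G w) = w) :
    IsDCMapOn univ G := by
  have key : ∀ w v, ∃ d : E, G (w + v) + G (w - v) - (2 : ℝ) • G w = (2 : ℝ) • d ∧
      0 ≤ f (G (w + v)) + f (G (w - v)) - 2 * f (G w) ∧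
      ‖d‖ ≤ 2 * L * (f (G (w + v)) + f (G (w - v)) - 2 * f (G w)) := by
    intro w v
    set x := G (w + v) with hx
    set y := G (w - v) with hy
    set z := G w with hz
    set m : E := (1 / 2 : ℝ) • (x + y) with hm
    have hxm : m + (1 / 2 : ℝ) • (x - y) = x := by rw [hm]; module
    have hym : m - (1 / 2 : ℝ) • (x - y) = y := by rw [hm]; module
    have h1 := hef m ((1 / 2 : ℝ) • (x - y))
    rw [hxm, hym] at h1
    have hx' := hAG (w + v)
    have hy' := hAG (w - v)
    have hz' := hAG w
    rw [← hx] at hx'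
    rw [← hy] at hy'
    rw [← hz] at hz'
    have h2 : A (m - z) = (-(1 / 2 : ℝ)) • (e x + e y - (2 : ℝ) • e m) - (e m - e z) := by
      have ex : A x = w + v - e x := eq_sub_of_add_eq hx'
      have ey : A y = w - v - e y := eq_sub_of_add_eq hy'
      have ez : A z = w - e z := eq_sub_of_add_eq hz'
      rw [hm, map_sub, map_smul, map_add, ex, ey, ez]
      module
    have h3 : ‖A (m - z)‖ ≤ 1 / 2 * (f x + f y - 2 * f m) + c * ‖m - z‖ := by
      rw [h2]
      refine (norm_sub_le _ _).trans (add_le_add ?_ (he m z))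
      rw [norm_smul]
      norm_num
      linarith
    have h4 := hA (m - z)
    have h5 := mul_le_mul_of_nonneg_left h3 hL
    have h6 := mul_le_mul_of_nonneg_right hLc (norm_nonneg (m - z))
    have h7 := (abs_le.1 (hf m z)).1
    set T := ‖m - z‖ with hT
    have hT0 : 0 ≤ T := norm_nonneg _
    set δ := f x + f y - 2 * f m with hδ
    have hδ0 : 0 ≤ δ := (norm_nonneg _).trans h1
    have h8 : T ≤ 2 / 3 * (L * δ) := by linarith
    have h9 := mul_le_mul_of_nonneg_left h8 hc
    have h10 := mul_le_mul_of_nonneg_right hLc hδ0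
    have h11 : 2 / 3 * δ ≤ f x + f y - 2 * f z := by linarith
    have h12 := mul_le_mul_of_nonneg_left h11 hL
    have h13 := mul_nonneg hL hδ0
    exact ⟨m - z, by rw [hm]; module, by linarith, by linarith⟩
  have hfGc : Continuous fun w => f (G w) := hfc.comp hG
  intro ℓ
  set ℓ' : E →L[ℝ] ℝ := LinearMap.toContinuousLinearMap ℓ with hℓ'
  set K : ℝ := 4 * ‖ℓ'‖ * L with hK
  have hK0 : 0 ≤ K := by positivity
  have hℓG : Continuous fun w => ℓ (G w) := ℓ'.continuous.comp hG
  have hgc : Continuous fun w => K * f (G w) := continuous_const.mul hfGc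
  refine ⟨fun w => ℓ (G w) + K * f (G w), fun w => K * f (G w), ?_, ?_,
    (hℓG.add hgc).continuousOn, hgc.continuousOn, fun x _ => by ring⟩
  · refine convexOn_of_eventually_midpoint convex_univ (hℓG.add hgc).continuousOn
      fun w _ => Eventually.of_forall fun v => ?_
    obtain ⟨d, hd, -, hd'⟩ := key w v
    have h1 : ℓ (G (w + v)) + ℓ (G (w - v)) - 2 * ℓ (G w) = 2 * ℓ d := by
      have := congrArg ℓ hd
      simpa using this
    have h2 : |ℓ d| ≤ ‖ℓ'‖ * ‖d‖ := ℓ'.le_opNorm d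
    have h3 := mul_le_mul_of_nonneg_left hd' (norm_nonneg ℓ')
    have h4 := (abs_le.1 h2).1
    simp only [hK]
    linarith
  · refine convexOn_of_eventually_midpoint convex_univ hgc.continuousOn
      fun w _ => Eventually.of_forall fun v => ?_
    obtain ⟨d, -, hd, -⟩ := key w v
    have := mul_nonneg hK0 hd
    linarith

theorem ConvexOn.add_fderiv_le {E : Type*} [NormedAddCommGroup E] [NormedSpace ℝ E]
    {C : Set E} {p : E → ℝ} (hp : ConvexOn ℝ C p) {p' : E →L[ℝ] ℝ} {x y : E}
    (hx : x ∈ C) (hy : y ∈ C) (hd : HasFDerivAt p p' x) : p x + p' (y - x) ≤ p y := by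
  have hlim := hd.lim_real (y - x)
  have : p' (y - x) ≤ p y - p x := by
    refine le_of_tendsto hlim ?_
    filter_upwards [eventually_ge_atTop (1 : ℝ)] with t ht
    have ht0 : 0 < t := by linarith
    have h1 := hp.2 hx hy (sub_nonneg.2 (inv_le_one_of_one_le₀ ht)) (inv_nonneg.2 ht0.le)
      (sub_add_cancel _ _)
    rw [show (1 - t⁻¹) • x + t⁻¹ • y = x + t⁻¹ • (y - x) by module] at h1
    simp only [smul_eq_mul] at h1 ⊢
    have h2 := mul_le_mul_of_nonneg_left h1 ht0.le
    have h3 : t * t⁻¹ = 1 := mul_inv_cancel₀ ht0.ne'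
    have h4 : t * ((1 - t⁻¹) * p x + t⁻¹ * p y) = t * p x + (t * t⁻¹) * (p y - p x) := by ring
    rw [h4, h3] at h2
    linarith
  linarith

/-- A function that has supporting affine functions at the points of `D`, with slopes `p' x` all
close to `φ`, agrees on `D` with a globally defined convex function that is close to `φ`. -/
theorem exists_convexOn_univ_eqOn {E : Type*} [NormedAddCommGroup E] [NormedSpace ℝ E]
    {D : Set E} (hD : D.Nonempty) {p : E → ℝ} {p' : E → E →L[ℝ] ℝ} {φ : E →L[ℝ] ℝ} {ε : ℝ}
    (hsup : ∀ x ∈ D, ∀ y ∈ D, p x + p' x (y - x) ≤ p y) (hφ : ∀ x ∈ D, ‖p' x - φ‖ ≤ ε) :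
    ∃ P : E → ℝ, ConvexOn ℝ univ P ∧ EqOn P p D ∧
      ∀ y z, |(P y - φ y) - (P z - φ z)| ≤ ε * ‖y - z‖ := by
  have : Nonempty D := hD.to_subtype
  have hop : ∀ x ∈ D, ∀ v, p' x v ≤ φ v + ε * ‖v‖ := fun x hx v => by
    have h1 := (le_abs_self _).trans ((p' x - φ).le_opNorm v)
    have h2 := mul_le_mul_of_nonneg_right (hφ x hx) (norm_nonneg v)
    simp only [sub_apply] at h1
    linarith
  have hbdd : ∀ y, BddAbove (range fun x : D => p x + p' x (y - x)) := by
    intro y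
    obtain ⟨x₀, hx₀⟩ := hD
    refine ⟨p x₀ + (φ (y - x₀) + ε * ‖y - x₀‖), ?_⟩
    rintro _ ⟨⟨x, hx⟩, rfl⟩
    have h1 := hsup x hx x₀ hx₀
    have h2 := hop x hx (y - x₀)
    have h3 : p' x (y - x) = p' x (y - x₀) + p' x (x₀ - x) := by
      rw [← map_add, sub_add_sub_cancel]
    simp only [h3]
    linarith
  set P : E → ℝ := fun y => ⨆ x : D, (p x + p' x (y - x)) with hP
  have hle : ∀ y (x : D), p x + p' x (y - x) ≤ P y := fun y x => le_ciSup (hbdd y) x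
  have hlip : ∀ y z, P y ≤ P z + (φ (y - z) + ε * ‖y - z‖) := by
    intro y z
    refine ciSup_le fun x => ?_
    have h1 := hle z x
    have h2 := hop x x.2 (y - z)
    have h3 : p' x (y - x) = p' x (y - z) + p' x (z - x) := by
      rw [← map_add, sub_add_sub_cancel]
    linarith
  refine ⟨P, ⟨convex_univ, fun y _ z _ a b ha hb hab => ciSup_le fun x => ?_⟩, fun y hy => ?_,
    fun y z => abs_le.2 ⟨?_, ?_⟩⟩
  · have h1 := mul_le_mul_of_nonneg_left (hle y x) ha
    have h2 := mul_le_mul_of_nonneg_left (hle z x) hb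
    have h3 : p x + p' x (a • y + b • z - x)
        = a * (p x + p' x (y - x)) + b * (p x + p' x (z - x)) := by
      simp only [map_sub, map_add, map_smul, smul_eq_mul]
      linear_combination (p' x x - p x) * hab
    rw [h3]
    exact add_le_add h1 h2
  · refine le_antisymm (ciSup_le fun x => hsup x x.2 y hy) ?_
    simpa using hle y ⟨y, hy⟩
  · have := hlip z y
    rw [norm_sub_rev, map_sub] at this
    linarith
  · have := hlip y z
    rw [map_sub] at this
    linarith

theorem HasFDerivAt.norm_le_of_forall_norm_sub_le {E F : Type*} [NormedAddCommGroup E]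
    [NormedSpace ℝ E] [NormedAddCommGroup F] [NormedSpace ℝ F] {f : E → F} {A : E →L[ℝ] F}
    {x : E} {s : Set E} {L : ℝ} (hf : HasFDerivAt f A x) (hs : s ∈ 𝓝 x)
    (h : ∀ y ∈ s, ‖y - x‖ ≤ L * ‖f y - f x‖) (v : E) : ‖v‖ ≤ L * ‖A v‖ := by
  have hlim := ((hf.lim_real v).norm).const_mul L
  refine ge_of_tendsto hlim ?_
  have h0 : Tendsto (fun t : ℝ => x + t⁻¹ • v) atTop (𝓝 x) := by
    simpa using tendsto_const_nhds.add ((tendsto_inv_atTop_zero (𝕜 := ℝ)).smul_const v)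
  filter_upwards [h0.eventually hs, eventually_gt_atTop (0 : ℝ)] with t ht ht0
  have h1 := mul_le_mul_of_nonneg_left (h _ ht) ht0.le
  rw [add_sub_cancel_left, norm_smul, norm_inv, Real.norm_of_nonneg ht0.le,
    mul_inv_cancel_left₀ ht0.ne'] at h1
  rw [norm_smul, Real.norm_of_nonneg ht0.le]
  linarith

theorem EuclideanSpace.norm_le_sum_abs {ι : Type*} [Fintype ι] (v : EuclideanSpace ℝ ι) :
    ‖v‖ ≤ ∑ i, |v i| := by
  rw [EuclideanSpace.norm_eq]
  refine Real.sqrt_le_iff.2 ⟨Finset.sum_nonneg fun i _ => abs_nonneg _, ?_⟩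
  simpa using Finset.sum_sq_le_sq_sum_of_nonneg (s := Finset.univ) (f := fun i => |v i|)
    fun i _ => abs_nonneg _

/-- On a set `D` where the derivatives of the convex components of a DC map `F = p - q` oscillate
little, `F` has a left inverse that is DC on the whole space. -/
theorem exists_isDCMapOn_univ_leftInvOn {n : ℕ}
    {F : EuclideanSpace ℝ (Fin n) → EuclideanSpace ℝ (Fin n)} {B D : Set (EuclideanSpace ℝ (Fin n))}
    {p q : Fin n → EuclideanSpace ℝ (Fin n) → ℝ} (hB : IsOpen B) (hDB : D ⊆ B)
    (hp : ∀ k, ConvexOn ℝ B (p k)) (hq : ∀ k, ConvexOn ℝ B (q k))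
    (hF : ∀ x ∈ B, ∀ k, F x k = p k x - q k x)
    (hpd : ∀ x ∈ D, ∀ k, DifferentiableAt ℝ (p k) x)
    (hqd : ∀ x ∈ D, ∀ k, DifferentiableAt ℝ (q k) x)
    {L ε : ℝ} (hL : 0 < L) (hε : 0 ≤ ε) (hLε : L * (n * (2 * ε)) ≤ 1 / 4)
    (hFL : ∀ x ∈ B, ∀ y ∈ B, ‖x - y‖ ≤ L * ‖F x - F y‖)
    (hpε : ∀ x ∈ D, ∀ y ∈ D, ∀ k, ‖fderiv ℝ (p k) x - fderiv ℝ (p k) y‖ ≤ ε)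
    (hqε : ∀ x ∈ D, ∀ y ∈ D, ∀ k, ‖fderiv ℝ (q k) x - fderiv ℝ (q k) y‖ ≤ ε) :
    ∃ g : EuclideanSpace ℝ (Fin n) → EuclideanSpace ℝ (Fin n),
      Continuous g ∧ IsDCMapOn univ g ∧ ∀ x ∈ D, g (F x) = x := by
  rcases D.eq_empty_or_nonempty with rfl | ⟨x₀, hx₀⟩
  · refine ⟨fun _ => 0, continuous_const, fun ℓ => ⟨fun _ => 0, fun _ => 0, ?_⟩, by simp⟩
    have : ConvexOn ℝ univ fun _ : EuclideanSpace ℝ (Fin n) => (0 : ℝ) :=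
      convexOn_const 0 convex_univ
    exact ⟨this, this, continuousOn_const, continuousOn_const, by simp⟩
  have hB' : ∀ x ∈ D, B ∈ 𝓝 x := fun x hx => hB.mem_nhds (hDB hx)
  choose P hPC hPD hPε using fun k => exists_convexOn_univ_eqOn ⟨x₀, hx₀⟩
    (fun x hx y hy => (hp k).add_fderiv_le (hDB hx) (hDB hy) (hpd x hx k).hasFDerivAt)
    (fun x hx => hpε x hx x₀ hx₀ k)
  choose Q hQC hQD hQε using fun k => exists_convexOn_univ_eqOn ⟨x₀, hx₀⟩
    (fun x hx y hy => (hq k).add_fderiv_le (hDB hx) (hDB hy) (hqd x hx k).hasFDerivAt)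
    (fun x hx => hqε x hx x₀ hx₀ k)
  set a : Fin n → EuclideanSpace ℝ (Fin n) → ℝ := fun k x => P k x - fderiv ℝ (p k) x₀ x with ha
  set b : Fin n → EuclideanSpace ℝ (Fin n) → ℝ := fun k x => Q k x - fderiv ℝ (q k) x₀ x with hb
  obtain ⟨A, hA⟩ : DifferentiableAt ℝ F x₀ := by
    rw [differentiableAt_euclidean]
    refine fun k => ((hpd x₀ hx₀ k).sub (hqd x₀ hx₀ k)).congr_of_eventuallyEq ?_
    filter_upwards [hB' x₀ hx₀] with x hx using hF x hx k
  have hAL : ∀ v, ‖v‖ ≤ L * ‖A v‖ := hA.norm_le_of_forall_norm_sub_le (hB' x₀ hx₀)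
    fun y hy => hFL y hy x₀ (hDB hx₀)
  have hAk : ∀ v k, A v k = fderiv ℝ (p k) x₀ v - fderiv ℝ (q k) x₀ v := by
    intro v k
    have h1 := (PiLp.hasFDerivAt_apply (𝕜 := ℝ) 2 (F x₀) k).comp x₀ hA
    have h2 : HasFDerivAt (fun x => F x k) (fderiv ℝ (p k) x₀ - fderiv ℝ (q k) x₀) x₀ := by
      refine ((hpd x₀ hx₀ k).hasFDerivAt.sub (hqd x₀ hx₀ k).hasFDerivAt).congr_of_eventuallyEq ?_
      filter_upwards [hB' x₀ hx₀] with x hx using hF x hx k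
    exact congrArg (fun T => T v) (h1.unique h2)
  set e : EuclideanSpace ℝ (Fin n) → EuclideanSpace ℝ (Fin n) :=
    fun x => WithLp.toLp 2 fun k => a k x - b k x with he
  set f : EuclideanSpace ℝ (Fin n) → ℝ := fun x => ∑ k, (a k x + b k x) with hf
  set c : ℝ := n * (2 * ε) with hc
  have hc0 : 0 ≤ c := by positivity
  have hsum : ∀ t : ℝ, ∑ _k : Fin n, 2 * (ε * t) = c * t := fun t => by
    simp [hc]
    ring
  have heL : ∀ x y, ‖e x - e y‖ ≤ c * ‖x - y‖ := by
    intro x y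
    refine (EuclideanSpace.norm_le_sum_abs _).trans ?_
    rw [← hsum]
    refine Finset.sum_le_sum fun k _ => ?_
    have h1 := abs_le.1 (hPε k x y)
    have h2 := abs_le.1 (hQε k x y)
    simp only [he, ha, hb, PiLp.sub_apply]
    exact abs_le.2 ⟨by linarith, by linarith⟩
  have hfL : ∀ x y, |f x - f y| ≤ c * ‖x - y‖ := by
    intro x y
    rw [hf, ← Finset.sum_sub_distrib, ← hsum]
    refine (Finset.abs_sum_le_sum_abs _ _).trans (Finset.sum_le_sum fun k _ => ?_)
    have h1 := abs_le.1 (hPε k x y)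
    have h2 := abs_le.1 (hQε k x y)
    simp only [ha, hb]
    exact abs_le.2 ⟨by linarith, by linarith⟩
  have hfc : Continuous f := (LipschitzWith.of_dist_le_mul (K := c.toNNReal) fun x y => by
    rw [Real.dist_eq, dist_eq_norm, Real.coe_toNNReal _ hc0]
    exact hfL x y).continuous
  have hef : ∀ m v, ‖e (m + v) + e (m - v) - (2 : ℝ) • e m‖
      ≤ f (m + v) + f (m - v) - 2 * f m := by
    intro m v
    refine (EuclideanSpace.norm_le_sum_abs _).trans ?_
    rw [hf, ← Finset.sum_add_distrib, Finset.mul_sum, ← Finset.sum_sub_distrib]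
    refine Finset.sum_le_sum fun k _ => ?_
    have h1 := (hPC k).two_mul_le_add_sub (mem_univ (m + v)) (mem_univ (m - v))
    have h2 := (hQC k).two_mul_le_add_sub (mem_univ (m + v)) (mem_univ (m - v))
    simp only [he, ha, hb, PiLp.sub_apply, PiLp.add_apply, PiLp.smul_apply, smul_eq_mul,
      map_add, map_sub]
    exact abs_le.2 ⟨by linarith, by linarith⟩
  have hinj : Function.Injective A := (injective_iff_map_eq_zero A).2 fun v hv => by
    have := hAL v
    rw [hv, norm_zero, mul_zero] at this
    exact norm_le_zero_iff.1 this
  set A' : EuclideanSpace ℝ (Fin n) ≃L[ℝ] EuclideanSpace ℝ (Fin n) :=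
    (LinearEquiv.ofInjectiveEndo (A : EuclideanSpace ℝ (Fin n) →ₗ[ℝ] _)
      hinj).toContinuousLinearEquiv with hA'
  have hAA' : (A' : EuclideanSpace ℝ (Fin n) →L[ℝ] EuclideanSpace ℝ (Fin n)) = A := by
    ext1 v
    rfl
  have happ : ApproximatesLinearOn (fun x => A x + e x)
      (A' : EuclideanSpace ℝ (Fin n) →L[ℝ] EuclideanSpace ℝ (Fin n)) univ c.toNNReal := by
    intro x _ y _
    rw [hAA', map_sub, add_sub_add_comm, add_sub_cancel_left, Real.coe_toNNReal _ hc0]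
    exact heL x y
  have hcN : Subsingleton (EuclideanSpace ℝ (Fin n)) ∨ c.toNNReal <
      ‖(A'.symm : EuclideanSpace ℝ (Fin n) →L[ℝ] EuclideanSpace ℝ (Fin n))‖₊⁻¹ := by
    refine A'.subsingleton_or_nnnorm_symm_pos.imp id fun hpos => ?_
    rw [NNReal.lt_inv_iff_mul_lt hpos.ne', ← NNReal.coe_lt_coe, NNReal.coe_mul,
      Real.coe_toNNReal _ hc0, coe_nnnorm]
    have hN : ‖(A'.symm : EuclideanSpace ℝ (Fin n) →L[ℝ] EuclideanSpace ℝ (Fin n))‖ ≤ L := by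
      refine ContinuousLinearMap.opNorm_le_bound _ hL.le fun v => ?_
      refine (hAL _).trans_eq ?_
      rw [← hAA']
      simp
    have := mul_le_mul_of_nonneg_left hN hc0
    rw [NNReal.coe_one]
    linarith
  set Φ := happ.toHomeomorph _ hcN with hΦ
  have hΦa : ∀ x, Φ x = A x + e x := fun x => rfl
  refine ⟨Φ.symm, Φ.symm.continuous, isDCMapOn_univ_of_rightInverse hL.le hc0 hLε hAL heL hfL hfc
    hef Φ.symm.continuous fun w => Φ.apply_symm_apply w, fun x hx => ?_⟩
  rw [Homeomorph.symm_apply_eq, hΦa]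
  ext k
  rw [hF x (hDB hx) k, PiLp.add_apply, hAk]
  simp only [he, ha, hb, hPD k hx, hQD k hx]
  ring

theorem IsDCOn.subset {E : Type*} [NormedAddCommGroup E] [NormedSpace ℝ E] {C C' : Set E}
    {f : E → ℝ} (h : IsDCOn C f) (hC' : Convex ℝ C') (hsub : C' ⊆ C) : IsDCOn C' f := by
  obtain ⟨p, q, hp, hq, hpc, hqc, hpq⟩ := h
  exact ⟨p, q, hp.subset hsub hC', hq.subset hsub hC', hpc.mono hsub, hqc.mono hsub,
    fun x hx => hpq x (hsub hx)⟩

/-- Let `U, V ⊆ ℝⁿ` be open and `F : U → V` a bijection such that both `F`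
and its inverse `G = F⁻¹` are Lipschitz, and `F` is locally DC on `U`. Then `F⁻¹` is
locally DC on `V`. -/
theorem locallyDCMapOn_inverse (n : ℕ)
    (U V : Set (EuclideanSpace ℝ (Fin n))) (hU : IsOpen U) (hV : IsOpen V)
    (F G : EuclideanSpace ℝ (Fin n) → EuclideanSpace ℝ (Fin n))
    (hFU : MapsTo F U V) (hGV : MapsTo G V U)
    (hGF : ∀ x ∈ U, G (F x) = x) (hFG : ∀ y ∈ V, F (G y) = y)
    (hFlip : ∃ K : ℝ≥0, LipschitzOnWith K F U)
    (hGlip : ∃ K : ℝ≥0, LipschitzOnWith K G V)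
    (hF : LocallyDCMapOn U F) :
    LocallyDCMapOn V G := by
  intro b hb
  obtain ⟨KF, hKF⟩ := hFlip
  obtain ⟨KG, hKG⟩ := hGlip
  obtain ⟨W, hWo, hWC, haW, hWU, hW⟩ := hF (G b) (hGV hb)
  choose p q hp hq hpc hqc hpq using fun k : Fin n =>
    hW (EuclideanSpace.proj (𝕜 := ℝ) k).toLinearMap
  choose Kp tp htp hKp using fun k => (hp k).locallyLipschitzOn hWo haW
  choose Kq tq htq hKq using fun k => (hq k).locallyLipschitzOn hWo haW
  simp only [hWo.nhdsWithin_eq haW] at htp htq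
  obtain ⟨r, hr, hrB⟩ : ∃ r > 0, Metric.ball (G b) r ⊆ W ∩ ((⋂ k, tp k) ∩ ⋂ k, tq k) :=
    Metric.mem_nhds_iff.1 (inter_mem (hWo.mem_nhds haW)
      (inter_mem (iInter_mem.2 htp) (iInter_mem.2 htq)))
  set B := Metric.ball (G b) r with hBdef
  have hBo : IsOpen B := Metric.isOpen_ball
  have hBC : Convex ℝ B := convex_ball _ _
  have hBW : B ⊆ W := fun x hx => (hrB hx).1
  have hBU : B ⊆ U := hBW.trans hWU
  have hlp : ∀ k, LipschitzOnWith (Kp k) (p k) B := fun k =>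
    (hKp k).mono fun x hx => mem_iInter.1 (hrB hx).2.1 k
  have hlq : ∀ k, LipschitzOnWith (Kq k) (q k) B := fun k =>
    (hKq k).mono fun x hx => mem_iInter.1 (hrB hx).2.2 k
  set D : Set (EuclideanSpace ℝ (Fin n)) :=
    B ∩ {x | x ∈ B → ∀ k, DifferentiableAt ℝ (p k) x ∧ DifferentiableAt ℝ (q k) x} with hD
  have hBD : B ⊆ closure D := by
    refine Dense.open_subset_closure_inter ?_ hBo
    refine MeasureTheory.Measure.dense_of_ae (μ := MeasureTheory.volume) ?_
    have h1 := MeasureTheory.ae_all_iff.2 fun k =>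
      (hlp k).ae_differentiableWithinAt_of_mem (μ := MeasureTheory.volume)
    have h2 := MeasureTheory.ae_all_iff.2 fun k =>
      (hlq k).ae_differentiableWithinAt_of_mem (μ := MeasureTheory.volume)
    filter_upwards [h1, h2] with x hx1 hx2 hx k
    exact ⟨(hx1 k hx).differentiableAt (hBo.mem_nhds hx),
      (hx2 k hx).differentiableAt (hBo.mem_nhds hx)⟩
  set L : ℝ := KG + 1 with hL
  have hL0 : 0 < L := by positivity
  have hFL : ∀ x ∈ B, ∀ y ∈ B, ‖x - y‖ ≤ L * ‖F x - F y‖ := by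
    intro x hx y hy
    have h1 := hKG.norm_sub_le (hFU (hBU hx)) (hFU (hBU hy))
    rw [hGF x (hBU hx), hGF y (hBU hy)] at h1
    have h2 := norm_nonneg (F x - F y)
    rw [hL]
    linarith
  set ε : ℝ := 1 / (8 * L * (n + 1)) with hε
  have hε0 : 0 < ε := by positivity
  have hLε : L * (n * (2 * ε)) ≤ 1 / 4 := by
    have h1 : L * ((n + 1) * (2 * ε)) = 1 / 4 := by
      rw [hε]
      field_simp
      norm_num
    have h2 : 0 ≤ L * ε := by positivity
    linarith
  set Ψ : EuclideanSpace ℝ (Fin n) → (Fin n → EuclideanSpace ℝ (Fin n) →L[ℝ] ℝ) ×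
    (Fin n → EuclideanSpace ℝ (Fin n) →L[ℝ] ℝ) :=
    fun x => (fun k => fderiv ℝ (p k) x, fun k => fderiv ℝ (q k) x) with hΨ
  have hΨb : Bornology.IsBounded (Ψ '' B) := by
    refine isBounded_iff_forall_norm_le.2 ⟨(∑ k, Kp k + ∑ k, Kq k : ℝ≥0), ?_⟩
    rintro _ ⟨x, hx, rfl⟩
    refine max_le ((pi_norm_le_iff_of_nonneg (NNReal.coe_nonneg _)).2 fun k => ?_)
      ((pi_norm_le_iff_of_nonneg (NNReal.coe_nonneg _)).2 fun k => ?_)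
    · refine (norm_fderiv_le_of_lipschitzOn ℝ (hBo.mem_nhds hx) (hlp k)).trans
        (NNReal.coe_le_coe.2 ?_)
      exact (Finset.single_le_sum (fun _ _ => zero_le) (Finset.mem_univ k)).trans le_self_add
    · refine (norm_fderiv_le_of_lipschitzOn ℝ (hBo.mem_nhds hx) (hlq k)).trans
        (NNReal.coe_le_coe.2 ?_)
      exact (Finset.single_le_sum (fun _ _ => zero_le) (Finset.mem_univ k)).trans le_add_self
  obtain ⟨T, hT, hTB⟩ := Metric.totallyBounded_iff.1
    (Metric.isCompact_of_isClosed_isBounded isClosed_closure hΨb.closure).totallyBounded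
    (ε / 2) (half_pos hε0)
  have : Fintype T := hT.fintype
  have hdist : ∀ t : T, ∀ x ∈ D ∩ Ψ ⁻¹' Metric.ball t (ε / 2),
      ∀ y ∈ D ∩ Ψ ⁻¹' Metric.ball t (ε / 2), ‖Ψ x - Ψ y‖ ≤ ε := by
    intro t x hx y hy
    rw [← dist_eq_norm]
    have h1 := dist_triangle_right (Ψ x) (Ψ y) t
    have h2 : dist (Ψ x) t < ε / 2 := hx.2
    have h3 : dist (Ψ y) t < ε / 2 := hy.2
    linarith
  choose g hgc hgDC hgF using fun t : T =>
    exists_isDCMapOn_univ_leftInvOn (F := F) (B := B) (D := D ∩ Ψ ⁻¹' Metric.ball t (ε / 2))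
      hBo (fun x hx => hx.1.1) (fun k => (hp k).subset hBW hBC) (fun k => (hq k).subset hBW hBC)
      (fun x hx k => hpq k x (hBW hx)) (fun x hx k => (hx.1.2 hx.1.1 k).1)
      (fun x hx k => (hx.1.2 hx.1.1 k).2) hL0 hε0.le hLε hFL
      (fun x hx y hy k => (norm_le_pi_norm (Ψ x - Ψ y).1 k).trans
        ((norm_fst_le _).trans (hdist t x hx y hy)))
      (fun x hx y hy k => (norm_le_pi_norm (Ψ x - Ψ y).2 k).trans
        ((norm_snd_le _).trans (hdist t x hx y hy)))
  have hsel : ∀ x ∈ B, ∃ t : T, g t (F x) = x := by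
    intro x hx
    have hDT : D ⊆ ⋃ t : T, D ∩ Ψ ⁻¹' Metric.ball t (ε / 2) := by
      intro y hy
      obtain ⟨t, ht, hyt⟩ := mem_iUnion₂.1 (hTB (subset_closure (mem_image_of_mem Ψ hy.1)))
      exact mem_iUnion.2 ⟨⟨t, ht⟩, hy, hyt⟩
    have hx' := closure_mono hDT (hBD hx)
    rw [closure_iUnion_of_finite] at hx'
    obtain ⟨t, ht⟩ := mem_iUnion.1 hx'
    have : (𝓝[D ∩ Ψ ⁻¹' Metric.ball t (ε / 2)] x).NeBot := mem_closure_iff_nhdsWithin_neBot.1 ht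
    have hFc : ContinuousAt F x := hKF.continuousOn.continuousAt (hU.mem_nhds (hBU hx))
    have h1 : Tendsto (fun y => g t (F y)) (𝓝[D ∩ Ψ ⁻¹' Metric.ball t (ε / 2)] x)
        (𝓝 (g t (F x))) :=
      ((hgc t).continuousAt.comp hFc).tendsto.mono_left nhdsWithin_le_nhds
    refine ⟨t, tendsto_nhds_unique h1 ?_⟩
    refine (tendsto_id.mono_left nhdsWithin_le_nhds).congr' ?_
    filter_upwards [self_mem_nhdsWithin] with y hy using (hgF t y hy).symm
  have hGc : ContinuousAt G b := hKG.continuousOn.continuousAt (hV.mem_nhds hb)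
  obtain ⟨ρ, hρ, hρV⟩ := Metric.mem_nhds_iff.1
    (inter_mem (hV.mem_nhds hb) (hGc (hBo.mem_nhds (Metric.mem_ball_self hr))))
  have hNV : Metric.ball b ρ ⊆ V := fun y hy => (hρV hy).1
  have hNC : Convex ℝ (Metric.ball b ρ) := convex_ball _ _
  refine ⟨Metric.ball b ρ, Metric.isOpen_ball, hNC, Metric.mem_ball_self hρ, hNV, fun ℓ => ?_⟩
  refine IsDCOn.of_forall_exists_eq Metric.isOpen_ball hNC (h := fun t y => ℓ (g t y))
    (ℓ.continuous_of_finiteDimensional.comp_continuousOn (hKG.continuousOn.mono hNV))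
    (fun t => (hgDC t ℓ).subset hNC (subset_univ _)) fun y hy => ?_
  obtain ⟨t, ht⟩ := hsel (G y) (hρV hy).2
  rw [hFG y (hNV hy)] at ht
  exact ⟨t, congrArg ℓ ht.symm⟩
end

section
/- Let n ≥ 2, let X ⊂ ℝ^{n+1} be a convex surface, and let (e,V) give a standard chart on X with associated convex function f. Let T ⊆ e^⊥ be an (n−1)-dimensional DC surface in the n-dimensional space e^⊥ with T ∩ V ≠ ∅. Then {x + f(x)e : x ∈ T ∩ V} is an (n−1)-dimensional DC surface in ℝ^{n+1}. -/
open scoped NNReal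

open Set

/-- A `k`-dimensional DC surface: a nonempty set which is locally the graph of a locally DC
mapping from (an open subset of) a `k`-dimensional linear subspace `Q` to `Qᗮ`. -/
def IsDCSurface {E : Type*} [NormedAddCommGroup E] [InnerProductSpace ℝ E]
    (k : ℕ) (T : Set E) : Prop :=
  T.Nonempty ∧ ∀ x ∈ T, ∃ Q : Submodule ℝ E, Module.finrank ℝ Q = k ∧
    ∃ W : Set E, IsOpen W ∧ x ∈ W ∧ ∃ G : Set Q, IsOpen G ∧
      ∃ h : Q → Qᗮ, LocallyDCMapOn G h ∧
        T ∩ W = (fun u : Q => (u : E) + ((h u : Qᗮ) : E)) '' G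

/-- A convex body: a compact convex set with nonempty interior. -/
def IsConvexBody {E : Type*} [NormedAddCommGroup E] [NormedSpace ℝ E] (C : Set E) : Prop :=
  IsCompact C ∧ Convex ℝ C ∧ (interior C).Nonempty

/-- A convex surface: the boundary of a convex body. -/
def IsConvexSurface {E : Type*} [NormedAddCommGroup E] [NormedSpace ℝ E] (X : Set E) : Prop :=
  ∃ C : Set E, IsConvexBody C ∧ X = frontier C

/-- An `(e,V)`-standard chart on `X`, given by a unit vector `e`, a convex open subset `V`
of the hyperplane `e^⊥`, and a Lipschitz convex function `f : V → ℝ` whose graph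
`{x + f(x)e : x ∈ V}` is a relatively open subset of `X`. -/
def IsStandardChart {E : Type*} [NormedAddCommGroup E] [InnerProductSpace ℝ E]
    (X : Set E) (e : E) (V : Set ↥((Submodule.span ℝ {e})ᗮ))
    (f : ↥((Submodule.span ℝ {e})ᗮ) → ℝ) : Prop :=
  ‖e‖ = 1 ∧ IsOpen V ∧ Convex ℝ V ∧ ConvexOn ℝ V f ∧
    (∃ K : ℝ≥0, LipschitzOnWith K f V) ∧
    ∃ O : Set E, IsOpen O ∧
      (fun x : ↥((Submodule.span ℝ {e})ᗮ) => (x : E) + f x • e) '' V = X ∩ O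

section DC

variable {E F G : Type*} [NormedAddCommGroup E] [NormedSpace ℝ E]
  [NormedAddCommGroup F] [NormedSpace ℝ F] [NormedAddCommGroup G] [NormedSpace ℝ G]

theorem IsDCOn.mono {C D : Set E} {f : E → ℝ} (hf : IsDCOn D f) (hCD : C ⊆ D)
    (hC : Convex ℝ C) : IsDCOn C f := by
  obtain ⟨g, h, hg, hh, hgc, hhc, e⟩ := hf
  exact ⟨g, h, hg.subset hCD hC, hh.subset hCD hC, hgc.mono hCD, hhc.mono hCD,
    fun x hx => e x (hCD hx)⟩

theorem IsDCOn.continuousOn {C : Set E} {f : E → ℝ} (hf : IsDCOn C f) : ContinuousOn f C := by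
  obtain ⟨g, h, -, -, hgc, hhc, e⟩ := hf
  exact (hgc.sub hhc).congr e

theorem IsDCOn.add {C : Set E} {f₁ f₂ : E → ℝ} (h₁ : IsDCOn C f₁) (h₂ : IsDCOn C f₂) :
    IsDCOn C (fun x => f₁ x + f₂ x) := by
  obtain ⟨g, h, hg, hh, hgc, hhc, e⟩ := h₁
  obtain ⟨g', h', hg', hh', hgc', hhc', e'⟩ := h₂
  refine ⟨g + g', h + h', hg.add hg', hh.add hh', hgc.add hgc', hhc.add hhc', fun x hx => ?_⟩
  simp only [e x hx, e' x hx, Pi.add_apply]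
  ring

theorem IsDCOn.mul_const {C : Set E} {f : E → ℝ} (hf : IsDCOn C f) (c : ℝ) :
    IsDCOn C (fun x => f x * c) := by
  obtain ⟨g, h, hg, hh, hgc, hhc, e⟩ := hf
  rcases le_total 0 c with hc | hc
  · refine ⟨c • g, c • h, hg.smul hc, hh.smul hc, hgc.const_smul c, hhc.const_smul c,
      fun x hx => ?_⟩
    simp only [e x hx, Pi.smul_apply, smul_eq_mul]
    ring
  · have hc' : 0 ≤ -c := by linarith
    refine ⟨(-c) • h, (-c) • g, hh.smul hc', hg.smul hc', hhc.const_smul _, hgc.const_smul _,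
      fun x hx => ?_⟩
    simp only [e x hx, Pi.smul_apply, smul_eq_mul]
    ring

theorem IsDCOn.comp_continuousLinearMap {C : Set F} {f : F → ℝ} (hf : IsDCOn C f)
    (L : E →L[ℝ] F) : IsDCOn (L ⁻¹' C) (fun x => f (L x)) := by
  obtain ⟨g, h, hg, hh, hgc, hhc, e⟩ := hf
  have hL : MapsTo L (L ⁻¹' C) C := fun _ hx => hx
  exact ⟨g ∘ L, h ∘ L, hg.comp_linearMap L.toLinearMap, hh.comp_linearMap L.toLinearMap,
    hgc.comp L.continuous.continuousOn hL, hhc.comp L.continuous.continuousOn hL,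
    fun x hx => e _ hx⟩

theorem IsDCMapOn.mono {C D : Set E} {Φ : E → F} (hΦ : IsDCMapOn D Φ) (hCD : C ⊆ D)
    (hC : Convex ℝ C) : IsDCMapOn C Φ :=
  fun ℓ => (hΦ ℓ).mono hCD hC

theorem IsDCMapOn.add {C : Set E} {Φ Ψ : E → F} (hΦ : IsDCMapOn C Φ) (hΨ : IsDCMapOn C Ψ) :
    IsDCMapOn C (fun x => Φ x + Ψ x) := fun ℓ => by
  simpa only [map_add] using (hΦ ℓ).add (hΨ ℓ)

theorem IsDCMapOn.linearMap_comp {C : Set E} {Φ : E → F} (hΦ : IsDCMapOn C Φ) (A : F →ₗ[ℝ] G) :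
    IsDCMapOn C (fun x => A (Φ x)) :=
  fun ℓ => hΦ (ℓ ∘ₗ A)

theorem IsDCMapOn.comp_continuousLinearMap {C : Set F} {Φ : F → G} (hΦ : IsDCMapOn C Φ)
    (L : E →L[ℝ] F) : IsDCMapOn (L ⁻¹' C) (fun x => Φ (L x)) :=
  fun ℓ => (hΦ ℓ).comp_continuousLinearMap L

theorem IsDCOn.smul_const {C : Set E} {f : E → ℝ} (hf : IsDCOn C f) (v : F) :
    IsDCMapOn C (fun x => f x • v) := fun ℓ => by
  simpa only [map_smul, smul_eq_mul] using hf.mul_const (ℓ v)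

theorem LinearMap.isDCMapOn [FiniteDimensional ℝ E] {C : Set E} (hC : Convex ℝ C)
    (A : E →ₗ[ℝ] F) : IsDCMapOn C A := fun ℓ =>
  ⟨ℓ ∘ₗ A, 0, (ℓ ∘ₗ A).convexOn hC, convexOn_const 0 hC,
    (ℓ ∘ₗ A).continuous_of_finiteDimensional.continuousOn, continuousOn_const, fun x _ => by simp⟩

theorem IsDCMapOn.continuousOn [FiniteDimensional ℝ F] {C : Set E} {Φ : E → F}
    (hΦ : IsDCMapOn C Φ) : ContinuousOn Φ C := by
  let b := Module.finBasis ℝ F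
  have h : ContinuousOn (fun x => ∑ i, b.coord i (Φ x) • b i) C :=
    continuousOn_finsetSum _ fun i _ => (hΦ (b.coord i)).continuousOn.smul continuousOn_const
  exact h.congr fun x _ => (b.sum_repr (Φ x)).symm

/-- A DC mapping into a finite-dimensional space has a convex control function, which bounds its
deviation from being affine. -/
theorem IsDCMapOn.exists_control [FiniteDimensional ℝ F] {C : Set E} {Φ : E → F}
    (hC : Convex ℝ C) (hΦ : IsDCMapOn C Φ) :
    ∃ φ : E → ℝ, ConvexOn ℝ C φ ∧ ContinuousOn φ C ∧
      ∀ x ∈ C, ∀ y ∈ C, ∀ s t : ℝ, 0 ≤ s → 0 ≤ t → s + t = 1 →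
        ‖Φ (s • x + t • y) - (s • Φ x + t • Φ y)‖ ≤ s * φ x + t * φ y - φ (s • x + t • y) := by
  let b := Module.finBasis ℝ F
  choose g h hg hh hgc hhc e using fun i => hΦ (b.coord i)
  let φ : E → ℝ := fun x => ∑ i, ‖b i‖ * (g i x + h i x)
  have hgap : ∀ x ∈ C, ∀ y ∈ C, ∀ s t : ℝ, 0 ≤ s → 0 ≤ t → s + t = 1 →
      ‖Φ (s • x + t • y) - (s • Φ x + t • Φ y)‖ ≤ s * φ x + t * φ y - φ (s • x + t • y) := by
    intro x hx y hy s t hs ht hst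
    have hz := hC hx hy hs ht hst
    set z := s • x + t • y
    have hφ : s * φ x + t * φ y - φ z = ∑ i, ‖b i‖ *
        (s * (g i x + h i x) + t * (g i y + h i y) - (g i z + h i z)) := by
      simp only [φ, Finset.mul_sum, ← Finset.sum_add_distrib, ← Finset.sum_sub_distrib]
      exact Finset.sum_congr rfl fun i _ => by ring
    rw [hφ, ← b.sum_repr (Φ z - (s • Φ x + t • Φ y))]
    refine (norm_sum_le _ _).trans (Finset.sum_le_sum fun i _ => ?_)
    rw [norm_smul, mul_comm]
    refine mul_le_mul_of_nonneg_left ?_ (norm_nonneg _)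
    have hgi := (hg i).2 hx hy hs ht hst
    have hhi := (hh i).2 hx hy hs ht hst
    have ex := e i x hx
    have ey := e i y hy
    have ez := e i z hz
    simp only [Module.Basis.coord_apply, smul_eq_mul] at hgi hhi ex ey ez
    simp only [map_sub, map_add, map_smul, Finsupp.coe_sub, Finsupp.coe_add, Finsupp.coe_smul,
      Pi.sub_apply, Pi.add_apply, Pi.smul_apply, smul_eq_mul, ex, ey, ez, Real.norm_eq_abs]
    rw [abs_le]
    constructor <;> linarith
  refine ⟨φ, ⟨hC, fun x hx y hy s t hs ht hst => ?_⟩, ?_, hgap⟩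
  · have := (norm_nonneg _).trans (hgap x hx y hy s t hs ht hst)
    simp only [smul_eq_mul]
    linarith
  · exact continuousOn_finsetSum _ fun i _ => continuousOn_const.mul ((hgc i).add (hhc i))

/-- A Lipschitz convex function composed with a DC mapping is DC. -/
theorem IsDCMapOn.convexOn_comp [FiniteDimensional ℝ F] {C : Set E} {V : Set F} {Φ : E → F}
    {f : F → ℝ} {K : ℝ≥0} (hC : Convex ℝ C) (hΦ : IsDCMapOn C Φ) (hf : ConvexOn ℝ V f)
    (hK : LipschitzOnWith K f V) (hV : MapsTo Φ C V) : IsDCOn C (fun x => f (Φ x)) := by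
  obtain ⟨φ, hφ, hφc, hgap⟩ := hΦ.exists_control hC
  have hKφ : ContinuousOn (fun x => (K : ℝ) * φ x) C := continuousOn_const.mul hφc
  refine ⟨fun x => f (Φ x) + K * φ x, fun x => K * φ x,
    ⟨hC, fun x hx y hy s t hs ht hst => ?_⟩, hφ.smul K.2,
    (hK.continuousOn.comp hΦ.continuousOn hV).add hKφ, hKφ, fun x _ => by ring⟩
  have h1 := hK.dist_le_mul _ (hV (hC hx hy hs ht hst)) _ (hf.1 (hV hx) (hV hy) hs ht hst)
  have h2 := hf.2 (hV hx) (hV hy) hs ht hst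
  have h3 := mul_le_mul_of_nonneg_left (hgap x hx y hy s t hs ht hst) K.2
  rw [Real.dist_eq, dist_eq_norm] at h1
  have h4 := (le_abs_self _).trans h1
  simp only [smul_eq_mul, NNReal.val_eq_coe] at *
  linarith

theorem LocallyDCMapOn.continuousOn [FiniteDimensional ℝ F] {U : Set E} {Φ : E → F}
    (hΦ : LocallyDCMapOn U Φ) : ContinuousOn Φ U := fun x hx => by
  obtain ⟨N, hN, -, hxN, -, hD⟩ := hΦ x hx
  exact (hD.continuousOn.continuousAt (hN.mem_nhds hxN)).continuousWithinAt

theorem LocallyDCMapOn.exists_ball_subset {U U' : Set E} {Φ : E → F} (hΦ : LocallyDCMapOn U Φ)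
    (hU' : IsOpen U') (hUU' : U' ⊆ U) {x : E} (hx : x ∈ U') :
    ∃ r > 0, Metric.ball x r ⊆ U' ∧ IsDCMapOn (Metric.ball x r) Φ := by
  obtain ⟨N, hN, -, hxN, -, hD⟩ := hΦ x (hUU' hx)
  obtain ⟨r, hr, hball⟩ := Metric.isOpen_iff.1 (hN.inter hU') x ⟨hxN, hx⟩
  exact ⟨r, hr, hball.trans inter_subset_right,
    hD.mono (hball.trans inter_subset_left) (convex_ball x r)⟩

end DC

/-- The graph of a Lipschitz convex function over a piece of a DC surface lying in a hyperplane is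
a DC surface of the same dimension. -/
theorem IsDCSurface.image_graph {E : Type*} [NormedAddCommGroup E] [InnerProductSpace ℝ E]
    [FiniteDimensional ℝ E] {k : ℕ} {H : Submodule ℝ E} {e : E} (he : e ∈ Hᗮ)
    {V : Set H} {f : H → ℝ} {K : ℝ≥0} (hV : IsOpen V) (hf : ConvexOn ℝ V f)
    (hK : LipschitzOnWith K f V) {T : Set H} (hT : IsDCSurface k T) (hTV : (T ∩ V).Nonempty) :
    IsDCSurface k ((fun x : H => (x : E) + f x • e) '' (T ∩ V)) := by
  refine ⟨hTV.image _, ?_⟩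
  rintro _ ⟨x, ⟨hxT, hxV⟩, rfl⟩
  obtain ⟨Q, hQ, W, hW, hxW, G, hG, h, hh, hgraph⟩ := hT.2 x hxT
  have hP : ∀ (z : H) (c : ℝ), H.orthogonalProjectionOnto ((z : E) + c • e) = z := fun z c => by
    rw [map_add, map_smul, Submodule.orthogonalProjectionOnto_mem_subspace_eq_self,
      Submodule.orthogonalProjectionOnto_apply_of_mem_orthogonal he, smul_zero,
      add_zero]
  let L : Q ≃ₗ[ℝ] Q.map H.subtype := Q.equivMapOfInjective H.subtype H.injective_subtype
  have hLcoe : ∀ u : Q, ((L u : Q.map H.subtype) : E) = ((u : H) : E) := fun u => rfl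
  let L' : Q.map H.subtype →L[ℝ] Q := L.symm.toLinearMap.toContinuousLinearMap
  have hL' : ∀ u : Q, L' (L u) = u := L.symm_apply_apply
  have hcoe : ∀ u, ((L' u : H) : E) = u := fun u => by
    rw [← hLcoe]
    exact congrArg Subtype.val (L.apply_symm_apply u)
  let A : Qᗮ →ₗ[ℝ] (Q.map H.subtype)ᗮ :=
    (H.subtype ∘ₗ Qᗮ.subtype).codRestrict _ fun w => by
      rintro _ ⟨q, hq, rfl⟩
      exact w.2 q hq
  have heQ : e ∈ (Q.map H.subtype)ᗮ := by
    rintro _ ⟨q, -, rfl⟩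
    exact he q q.2
  let Φ : Q → H := fun u => (u : H) + (h u : H)
  have hΦ : ∀ C : Set Q, Convex ℝ C → IsDCMapOn C h → IsDCMapOn C Φ := fun C hC hD =>
    (LinearMap.isDCMapOn hC Q.subtype).add (hD.linearMap_comp Qᗮ.subtype)
  have hΦc : ContinuousOn Φ G :=
    continuous_subtype_val.continuousOn.add
      (continuous_subtype_val.comp_continuousOn hh.continuousOn)
  have hG' : IsOpen (G ∩ Φ ⁻¹' V) := hΦc.isOpen_inter_preimage hG hV
  refine ⟨Q.map H.subtype, L.finrank_eq.symm.trans hQ, H.orthogonalProjectionOnto ⁻¹' W,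
    hW.preimage H.orthogonalProjectionOnto.continuous, by simpa only [mem_preimage, hP],
    L' ⁻¹' (G ∩ Φ ⁻¹' V), hG'.preimage L'.continuous,
    fun u => A (h (L' u)) + f (Φ (L' u)) • ⟨e, heQ⟩, fun u hu => ?_, ?_⟩
  · obtain ⟨r, hr, hball, hD⟩ := hh.exists_ball_subset hG' inter_subset_left hu
    have hB := convex_ball (L' u) r
    refine ⟨L' ⁻¹' Metric.ball (L' u) r, Metric.isOpen_ball.preimage L'.continuous,
      hB.linear_preimage L'.toLinearMap, Metric.mem_ball_self hr, preimage_mono hball, ?_⟩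
    have hfΦ := (hΦ _ hB hD).convexOn_comp hB hf hK fun v hv => (hball hv).2
    exact ((hD.linearMap_comp A).add (hfΦ.smul_const _)).comp_continuousLinearMap L'
  · ext y
    constructor
    · rintro ⟨⟨z, ⟨hzT, hzV⟩, rfl⟩, hzW⟩
      rw [mem_preimage, hP] at hzW
      obtain ⟨u, huG, rfl⟩ := hgraph.subset ⟨hzT, hzW⟩
      refine ⟨L u, ?_, ?_⟩
      · rw [mem_preimage, hL']
        exact ⟨huG, hzV⟩
      · simp only [hL', hLcoe]
        exact (add_assoc _ _ _).symm
    · rintro ⟨u, ⟨huG, huV⟩, rfl⟩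
      obtain ⟨hzT, hzW⟩ := hgraph.superset ⟨L' u, huG, rfl⟩
      have heq : (u : E) + ((A (h (L' u)) + f (Φ (L' u)) • ⟨e, heQ⟩ : (Q.map H.subtype)ᗮ) : E) =
          (Φ (L' u) : E) + f (Φ (L' u)) • e := by
        rw [← hcoe u]
        exact (add_assoc _ _ _).symm
      refine ⟨⟨Φ (L' u), ⟨hzT, huV⟩, heq.symm⟩, ?_⟩
      simp only [mem_preimage, heq, hP]
      exact hzW

/-- Let `n ≥ 2`, `X ⊂ ℝ^{n+1}` a convex surface with an `(e,V)`-standard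
chart with associated convex function `f`. If `T ⊆ e^⊥` is an `(n-1)`-dimensional DC
surface in the `n`-dimensional space `e^⊥` meeting `V`, then `{x + f(x)e : x ∈ T ∩ V}` is
an `(n-1)`-dimensional DC surface in `ℝ^{n+1}`. -/
theorem image_of_DC_surface_under_chart (n : ℕ) (hn : 2 ≤ n)
    (X : Set (EuclideanSpace ℝ (Fin (n + 1)))) (hX : IsConvexSurface X)
    (e : EuclideanSpace ℝ (Fin (n + 1)))
    (V : Set ↥((Submodule.span ℝ {e})ᗮ)) (f : ↥((Submodule.span ℝ {e})ᗮ) → ℝ)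
    (hchart : IsStandardChart X e V f)
    (T : Set ↥((Submodule.span ℝ {e})ᗮ))
    (hT : IsDCSurface (n - 1) T) (hTV : (T ∩ V).Nonempty) :
    IsDCSurface (n - 1)
      ((fun x : ↥((Submodule.span ℝ {e})ᗮ) => (x : EuclideanSpace ℝ (Fin (n + 1))) + f x • e) ''
        (T ∩ V)) := by
  obtain ⟨-, hV, -, hf, ⟨K, hK⟩, -⟩ := hchart
  exact hT.image_graph
    (Submodule.le_orthogonal_orthogonal _ (Submodule.mem_span_singleton_self e)) hV hf hK hTV
end
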